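/- Let κ > 0 with κ ∉ ℕ. Then for every M > 0 there exists H₀ such that for all integers H ≥ H₀ and all real y with 1/(2·⌊H^κ⌋) ≤ y ≤ 1/2, one has Σ_{ℓ=1}^{H} ‖⌊ℓ^κ⌋·y‖² ≥ M·log H. -/

import Mathlib

open Filter Topology Real

/-- The Piatetski-Shapiro part: `⌊ℓ^κ⌋`. -/
noncomputable def psPart (κ : ℝ) (ℓ : ℕ) : ℕ := ⌊(ℓ : ℝ) ^ κ⌋₊

/-- Distance from a real number to the nearest integer. -/
noncomputable def nid (t : ℝ) : ℝ := |t - round t|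

theorem fwdDiff_iter_hasDerivAt {F G : ℝ → ℝ} (h : ∀ x, 0 < x → HasDerivAt F (G x) x) (j : ℕ) :
    ∀ x, 0 < x → HasDerivAt ((fwdDiff 1)^[j] F) ((fwdDiff 1)^[j] G x) x := by
  induction j generalizing F G with
  | zero => simpa using h
  | succ j ih =>
    simp only [Function.iterate_succ_apply]
    refine ih fun x hx => ?_
    have h1 : HasDerivAt (fun z => F (z + 1)) (G (x + 1)) x :=
      (h (x + 1) (by linarith)).comp_add_const x 1
    exact h1.sub (h x hx)

theorem fwdDiff_iter_rpow (j : ℕ) (r x : ℝ) (hx : 0 < x) :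
    ∃ ξ, x ≤ ξ ∧ (fwdDiff 1)^[j] (fun z : ℝ => z ^ r) x =
      (∏ i ∈ Finset.range j, (r - i)) * ξ ^ (r - j) := by
  induction j generalizing r x with
  | zero => exact ⟨x, le_rfl, by simp⟩
  | succ j ih =>
    have hd : ∀ z : ℝ, 0 < z → HasDerivAt ((fwdDiff 1)^[j] (fun z : ℝ => z ^ r))
        (r * (fwdDiff 1)^[j] (fun z : ℝ => z ^ (r - 1)) z) z := by
      intro z hz
      have := fwdDiff_iter_hasDerivAt (F := fun z : ℝ => z ^ r)
        (G := r • fun z : ℝ => z ^ (r - 1))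
        (fun y hy => by simpa using Real.hasDerivAt_rpow_const (p := r) (Or.inl hy.ne')) j z hz
      rw [fwdDiff_iter_const_smul] at this
      simpa using this
    obtain ⟨z, hz, hz'⟩ := exists_hasDerivAt_eq_slope ((fwdDiff 1)^[j] (fun z : ℝ => z ^ r)) _
      (show x < x + 1 by linarith)
      (fun z hz => (hd z (by linarith [hz.1])).continuousAt.continuousWithinAt)
      (fun z hz => hd z (by linarith [hz.1]))
    obtain ⟨ξ, hξ, e⟩ := ih (r - 1) z (by linarith [hz.1])
    refine ⟨ξ, by linarith [hz.1], ?_⟩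
    rw [Function.iterate_succ_apply', fwdDiff]
    rw [e] at hz'
    have h2 : r - 1 - (j : ℝ) = r - ((j + 1 : ℕ) : ℝ) := by push_cast; ring
    have h3 : ∏ i ∈ Finset.range j, (r - ((i + 1 : ℕ) : ℝ)) =
        ∏ i ∈ Finset.range j, (r - 1 - (i : ℝ)) :=
      Finset.prod_congr rfl fun i _ => by push_cast; ring
    rw [Finset.prod_range_succ', h3, ← h2]
    simp only [add_sub_cancel_left, div_one] at hz'
    rw [← hz']
    push_cast
    ring

theorem fwdDiff_iter_natCast (F : ℝ → ℝ) (j n : ℕ) :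
    (fwdDiff 1)^[j] (fun m : ℕ => F m) n = (fwdDiff 1)^[j] F (n : ℝ) := by
  simp [fwdDiff_iter_eq_sum_shift]

/-- Modulo the integers, `v` lies just below `c` for `K` steps from `s` on, and just above `c`
for the next `K` steps. -/
def Crosses (v : ℕ → ℝ) (c η : ℝ) (K s : ℕ) : Prop :=
  (∀ i < K, ∃ n : ℤ, v (s + i) - n ∈ Set.Ico (c - η) c) ∧
    ∀ i < K, ∃ n : ℤ, v (s + K + i) - n ∈ Set.Icc c (c + η)

theorem exists_crossing {w : ℕ → ℝ} {δ x : ℝ} {K T : ℕ}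
    (hw : ∀ i < T + K, 0 ≤ w (i + 1) - w i ∧ w (i + 1) - w i ≤ δ)
    (h0 : w 0 + K * δ < x) (hT : x ≤ w T) (hδ : 0 ≤ δ) :
    ∃ r, r + K ≤ T ∧ (∀ i < K, w (r + i) ∈ Set.Ico (x - K * δ) x) ∧
      ∀ i < K, w (r + K + i) ∈ Set.Icc x (x + K * δ) := by
  classical
  have key : ∀ b a, a + b ≤ T + K → 0 ≤ w (a + b) - w a ∧ w (a + b) - w a ≤ b * δ := by
    intro b
    induction b with
    | zero => intro a _; simp
    | succ b ih =>
      intro a hab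
      have h1 := ih a (by omega)
      have h2 := hw (a + b) (by omega)
      rw [← add_assoc]
      push_cast
      constructor <;> linarith [h1.1, h1.2, h2.1, h2.2]
  have hex : ∃ m, x ≤ w m := ⟨T, hT⟩
  obtain ⟨m, hm, hmin⟩ : ∃ m, x ≤ w m ∧ ∀ i < m, w i < x :=
    ⟨Nat.find hex, Nat.find_spec hex, fun i hi => not_le.1 (Nat.find_min hex hi)⟩
  have hmT : m ≤ T := by
    by_contra h
    exact absurd hT (not_le.2 (hmin T (by omega)))
  have hKm : K < m := by
    by_contra h
    have h1 := (key m 0 (by omega)).2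
    have h2 : (m : ℝ) ≤ K := by exact_mod_cast not_lt.1 h
    have h3 := mul_le_mul_of_nonneg_right h2 hδ
    rw [zero_add] at h1
    linarith
  obtain ⟨r, rfl⟩ : ∃ r, m = r + K := ⟨m - K, by omega⟩
  refine ⟨r, hmT, fun i hi => ⟨?_, hmin _ (by omega)⟩, fun i hi => ⟨?_, ?_⟩⟩
  · have h1 := (key (K - i) (r + i) (by omega)).2
    rw [show r + i + (K - i) = r + K by omega] at h1
    have h2 : ((K - i : ℕ) : ℝ) ≤ K := by exact_mod_cast Nat.sub_le K i
    have h3 := mul_le_mul_of_nonneg_right h2 hδ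
    linarith
  · have h1 := (key i (r + K) (by omega)).1
    linarith
  · have h1 := (key (i + 1) (r + K - 1) (by omega)).2
    rw [show r + K - 1 + (i + 1) = r + K + i by omega] at h1
    have h2 : ((i + 1 : ℕ) : ℝ) ≤ K := by exact_mod_cast hi
    have h3 := mul_le_mul_of_nonneg_right h2 hδ
    have h4 := hmin (r + K - 1) (by omega)
    linarith

theorem exists_crosses_of_fwdDiff {v : ℕ → ℝ} {δ : ℝ} {K T : ℕ} (hδ : 0 < δ) (c : ℝ)
    (hv : ∀ i < T + K, ∃ n : ℤ, v (i + 1) - v i - n ∈ Set.Icc (δ / 2) δ)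
    (hT : K * δ + 2 ≤ T * (δ / 2)) : ∃ r, r + K ≤ T ∧ Crosses v c (K * δ) K r := by
  have hv' : ∀ i, ∃ n : ℤ, i < T + K → v (i + 1) - v i - n ∈ Set.Icc (δ / 2) δ := by
    intro i
    by_cases hi : i < T + K
    · obtain ⟨n, hn⟩ := hv i hi
      exact ⟨n, fun _ => hn⟩
    · exact ⟨0, fun h => absurd h hi⟩
  choose n hn using hv'
  set w : ℕ → ℝ := fun i => v i - ((∑ j ∈ Finset.range i, n j : ℤ) : ℝ) with hwdef
  have hstep : ∀ i < T + K, w (i + 1) - w i ∈ Set.Icc (δ / 2) δ := by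
    intro i hi
    have := hn i hi
    have e : w (i + 1) - w i = v (i + 1) - v i - n i := by
      simp only [hwdef, Finset.sum_range_succ]
      push_cast
      ring
    rwa [e]
  have hgrow : ∀ t ≤ T, w 0 + t * (δ / 2) ≤ w t := by
    intro t
    induction t with
    | zero => simp
    | succ t ih =>
      intro ht
      have h1 := ih (by omega)
      have h2 := (hstep t (by omega)).1
      push_cast
      linarith
  set q : ℤ := ⌊w 0 + K * δ - c⌋ + 1 with hq
  have hq1 : w 0 + K * δ < c + q := by
    have := Int.lt_floor_add_one (w 0 + K * δ - c)
    rw [hq]; push_cast; linarith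
  have hq2 : c + q ≤ w 0 + K * δ + 1 := by
    have := Int.floor_le (w 0 + K * δ - c)
    rw [hq]; push_cast; linarith
  obtain ⟨r, hr, h1, h2⟩ := exists_crossing (w := w) (x := c + q) (δ := δ) (K := K) (T := T)
    (fun i hi => ⟨by linarith [(hstep i hi).1], (hstep i hi).2⟩) hq1
    (by linarith [hgrow T le_rfl]) hδ.le
  refine ⟨r, hr, fun i hi => ⟨∑ j ∈ Finset.range (r + i), n j + q, ?_⟩,
    fun i hi => ⟨∑ j ∈ Finset.range (r + K + i), n j + q, ?_⟩⟩
  · have := h1 i hi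
    simp only [hwdef, Set.mem_Ico] at this
    constructor <;> push_cast at this ⊢ <;> linarith [this.1, this.2]
  · have := h2 i hi
    simp only [hwdef, Set.mem_Icc] at this
    constructor <;> push_cast at this ⊢ <;> linarith [this.1, this.2]

theorem Crosses.mono {v : ℕ → ℝ} {c η η' : ℝ} {K s : ℕ} (h : Crosses v c η K s) (hη : η ≤ η') :
    Crosses v c η' K s :=
  ⟨fun i hi => (h.1 i hi).imp fun _ hn => ⟨by linarith [hn.1], hn.2⟩,
    fun i hi => (h.2 i hi).imp fun _ hn => ⟨hn.1, by linarith [hn.2]⟩⟩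

theorem exists_crosses_descend {η₀ : ℝ} (hη₀ : 0 < η₀) (K₀ j : ℕ) :
    ∃ (c η : ℝ) (K : ℕ), 0 < η ∧ η ≤ η₀ ∧ ∀ (u : ℕ → ℝ) (s : ℕ),
      Crosses ((fwdDiff 1)^[j] u) c η K s → ∃ r, s ≤ r ∧ r + 2 * K₀ ≤ s + 2 * K ∧
        Crosses u 0 η₀ K₀ r := by
  induction j with
  | zero => exact ⟨0, η₀, K₀, hη₀, le_rfl, fun u s h => ⟨s, le_rfl, le_rfl, h⟩⟩
  | succ j ih =>
    obtain ⟨c, η, K, hη, hηη, ih⟩ := ih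
    obtain ⟨δ, hδ, hδη, hKδ⟩ : ∃ δ : ℝ, 0 < δ ∧ δ ≤ η ∧ K * δ ≤ η := by
      refine ⟨η / (K + 1), by positivity, div_le_self hη.le (by simp), ?_⟩
      rw [mul_div_assoc', div_le_iff₀ (by positivity)]
      nlinarith
    obtain ⟨T, hT⟩ := exists_nat_ge ((K * δ + 2) / (δ / 2))
    rw [div_le_iff₀ (by positivity)] at hT
    refine ⟨δ / 2, δ / 2, T + 2 * K, by positivity, by linarith, fun u s h => ?_⟩
    obtain ⟨r, hr, hc⟩ := exists_crosses_of_fwdDiff (K := K) (T := T)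
      (v := fun i => (fwdDiff 1)^[j] u (s + (T + 2 * K) + i)) hδ c (fun i hi => by
        obtain ⟨n, hn⟩ := h.2 i (by omega)
        rw [Function.iterate_succ_apply', fwdDiff] at hn
        refine ⟨n, ?_⟩
        rw [add_halves] at hn
        exact hn) hT
    have hc' : Crosses ((fwdDiff 1)^[j] u) c η K (s + (T + 2 * K) + r) := by
      have := hc.mono hKδ
      simpa only [Crosses, add_assoc] using this
    obtain ⟨r', h1, h2, h3⟩ := ih u _ hc'
    exact ⟨r', by omega, by omega, h3⟩

theorem fwdDiff_floor_eq_one {u : ℕ → ℝ} {k s : ℕ} {η : ℝ} (hu : ∀ i, 0 ≤ u i)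
    (hη : 2 ^ (k + 1) * η ≤ 1 / 4) (hc : Crosses u 0 η (k + 1) s)
    (hd : |(fwdDiff 1)^[k + 1] u s| ≤ 1 / 4) :
    (fwdDiff 1)^[k + 1] (fun i => (⌊u i⌋₊ : ℝ)) s = 1 := by
  have hη1 : η < 1 := by
    have : (1 : ℝ) ≤ 2 ^ (k + 1) := one_le_pow₀ (by norm_num)
    nlinarith
  set a : ℕ → ℝ := fun i => (⌊u i⌋₊ : ℝ)
  have hfl : ∀ i, a i = (⌊u i⌋ : ℝ) := fun i => natCast_floor_eq_intCast_floor (hu i)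
  set b : ℕ → ℝ := fun l => if l = k + 1 then 1 else 0 with hb
  have herr : ∀ l ∈ Finset.range (k + 1 + 1), |a (s + l) - u (s + l) + 1 - b l| ≤ η := by
    intro l hl
    rw [Finset.mem_range] at hl
    rcases Nat.lt_succ_iff_lt_or_eq.1 hl with h | rfl
    · obtain ⟨n, hn1, hn2⟩ := hc.1 l h
      have : ⌊u (s + l)⌋ = n - 1 := by
        rw [Int.floor_eq_iff]
        push_cast
        constructor <;> linarith
      rw [hfl, this, hb]
      simp only [h.ne, if_false]
      push_cast
      rw [abs_le]
      constructor <;> linarith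
    · obtain ⟨n, hn1, hn2⟩ := hc.2 0 (by omega)
      rw [add_zero] at hn1 hn2
      have : ⌊u (s + (k + 1))⌋ = n := by
        rw [Int.floor_eq_iff]
        constructor <;> linarith
      rw [hfl, this, hb]
      simp only [if_true]
      rw [abs_le]
      constructor <;> linarith
  have hzero : ∑ l ∈ Finset.range (k + 1 + 1), (((-1 : ℤ) ^ (k + 1 - l) * (k + 1).choose l : ℤ) : ℝ)
      = 0 := by
    have := congrFun (fwdDiff_iter_pow_eq_zero_of_lt (R := ℝ) (Nat.succ_pos k)) 0
    rw [fwdDiff_iter_eq_sum_shift] at this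
    simpa using this
  have hone : ∑ l ∈ Finset.range (k + 1 + 1),
      (((-1 : ℤ) ^ (k + 1 - l) * (k + 1).choose l : ℤ) : ℝ) * b l = 1 := by
    rw [Finset.sum_eq_single (k + 1)]
    · simp [hb]
    · intro l _ hl
      simp [hb, hl]
    · simp
  have habs : ∑ l ∈ Finset.range (k + 1 + 1),
      |(((-1 : ℤ) ^ (k + 1 - l) * (k + 1).choose l : ℤ) : ℝ)| = 2 ^ (k + 1) := by
    have := Nat.sum_range_choose (k + 1)
    rw [← Nat.cast_inj (R := ℝ)] at this
    push_cast at this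
    rw [← this]
    refine Finset.sum_congr rfl fun l _ => ?_
    push_cast
    rw [abs_mul, abs_pow, abs_neg, abs_one, one_pow, one_mul, Nat.abs_cast]
  obtain ⟨D, hD⟩ : ∃ D : ℤ, (fwdDiff 1)^[k + 1] a s = D := by
    refine ⟨∑ l ∈ Finset.range (k + 1 + 1),
      ((-1 : ℤ) ^ (k + 1 - l) * (k + 1).choose l) * ⌊u (s + l)⌋, ?_⟩
    rw [fwdDiff_iter_eq_sum_shift]
    push_cast
    refine Finset.sum_congr rfl fun l _ => ?_
    rw [zsmul_eq_mul, smul_eq_mul, mul_one, hfl]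
    push_cast
    rfl
  have hsplit : (fwdDiff 1)^[k + 1] a s - (fwdDiff 1)^[k + 1] u s - 1 =
      ∑ l ∈ Finset.range (k + 1 + 1), (((-1 : ℤ) ^ (k + 1 - l) * (k + 1).choose l : ℤ) : ℝ) *
        (a (s + l) - u (s + l) + 1 - b l) := by
    rw [fwdDiff_iter_eq_sum_shift, fwdDiff_iter_eq_sum_shift]
    simp only [zsmul_eq_mul, smul_eq_mul, mul_one, mul_add, mul_sub, Finset.sum_add_distrib,
      Finset.sum_sub_distrib]
    rw [hzero, hone]
    ring
  have hbound : |(fwdDiff 1)^[k + 1] a s - (fwdDiff 1)^[k + 1] u s - 1| ≤ 1 / 4 := by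
    rw [hsplit]
    refine (Finset.abs_sum_le_sum_abs _ _).trans (le_trans ?_ hη)
    rw [← habs, Finset.sum_mul]
    refine Finset.sum_le_sum fun l hl => ?_
    rw [abs_mul]
    exact mul_le_mul_of_nonneg_left (herr l hl) (abs_nonneg _)
  rw [hD] at hbound ⊢
  rw [abs_le] at hbound hd
  have h1 : (D : ℝ) < 2 := by linarith [hbound.2, hd.2]
  have h2 : (0 : ℝ) < D := by linarith [hbound.1, hd.1]
  have h3 : D < 2 := by exact_mod_cast h1
  have h4 : 0 < D := by exact_mod_cast h2
  have h5 : D = 1 := by omega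
  rw [h5, Int.cast_one]

theorem nid_eq_self {t : ℝ} (h0 : 0 ≤ t) (h1 : t ≤ 1 / 2) : nid t = t := by
  refine le_antisymm ?_ ?_
  · simpa [nid, abs_of_nonneg h0] using round_le t 0
  · unfold nid
    rcases le_or_gt (round t) 0 with h | h
    · have : ((round t : ℤ) : ℝ) ≤ 0 := by exact_mod_cast h
      linarith [le_abs_self (t - round t)]
    · have : (1 : ℝ) ≤ ((round t : ℤ) : ℝ) := by exact_mod_cast h
      linarith [neg_abs_le (t - round t)]

theorem nid_sum_mul_le {ι : Type*} (s : Finset ι) (c : ι → ℤ) (t : ι → ℝ) :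
    nid (∑ i ∈ s, c i * t i) ≤ ∑ i ∈ s, |(c i : ℝ)| * nid (t i) := by
  have h := round_le (∑ i ∈ s, c i * t i) (∑ i ∈ s, c i * round (t i))
  refine h.trans ?_
  push_cast
  rw [← Finset.sum_sub_distrib]
  refine (Finset.abs_sum_le_sum_abs _ _).trans (Finset.sum_le_sum fun i _ => ?_)
  rw [← mul_sub, abs_mul, nid]

theorem exists_sq_le_sum_nid_sq (n : ℕ) : ∃ C : ℝ, 0 < C ∧ ∀ (a : ℕ → ℕ) (s : ℕ) (y : ℝ),
    0 ≤ y → y ≤ 1 / 2 → (fwdDiff 1)^[n] (fun i => (a i : ℝ)) s = 1 →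
      y ^ 2 ≤ C * ∑ l ∈ Finset.range (n + 1), nid (a (s + l) * y) ^ 2 := by
  set c : ℕ → ℤ := fun l => (-1 : ℤ) ^ (n - l) * n.choose l with hc
  refine ⟨∑ l ∈ Finset.range (n + 1), |(c l : ℝ)| ^ 2 + 1,
    add_pos_of_nonneg_of_pos (Finset.sum_nonneg fun _ _ => sq_nonneg _) one_pos,
    fun a s y hy0 hy1 h => ?_⟩
  rw [fwdDiff_iter_eq_sum_shift] at h
  have hy : y = ∑ l ∈ Finset.range (n + 1), c l * (a (s + l) * y) := by
    calc y = (∑ l ∈ Finset.range (n + 1), ((-1 : ℤ) ^ (n - l) * n.choose l) •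
          (a (s + l • 1) : ℝ)) * y := by rw [h, one_mul]
      _ = _ := by
        rw [Finset.sum_mul]
        refine Finset.sum_congr rfl fun l _ => ?_
        rw [zsmul_eq_mul, smul_eq_mul, mul_one, mul_assoc]
  have h1 : y ≤ ∑ l ∈ Finset.range (n + 1), |(c l : ℝ)| * nid (a (s + l) * y) := by
    calc y = nid y := (nid_eq_self hy0 hy1).symm
      _ ≤ _ := by
        nth_rewrite 1 [hy]
        exact nid_sum_mul_le _ _ _
  have h2 := Finset.sum_mul_sq_le_sq_mul_sq (Finset.range (n + 1)) (fun l => |(c l : ℝ)|)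
    (fun l => nid (a (s + l) * y))
  have h3 : 0 ≤ ∑ l ∈ Finset.range (n + 1), nid (a (s + l) * y) ^ 2 :=
    Finset.sum_nonneg fun _ _ => sq_nonneg _
  nlinarith [pow_le_pow_left₀ hy0 h1 2]

theorem sum_sum_shift_le {F : ℕ → ℝ} (hF : ∀ i, 0 ≤ F i) {S : Finset ℕ} {n H : ℕ}
    (hS : ∀ i ∈ S, 1 ≤ i ∧ i + n ≤ H) :
    ∑ i ∈ S, ∑ l ∈ Finset.range (n + 1), F (i + l) ≤ (n + 1) * ∑ i ∈ Finset.Icc 1 H, F i := by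
  rw [Finset.sum_comm]
  have : ∀ l ∈ Finset.range (n + 1), ∑ i ∈ S, F (i + l) ≤ ∑ i ∈ Finset.Icc 1 H, F i := by
    intro l hl
    rw [Finset.mem_range] at hl
    rw [← Finset.sum_image (s := S) (g := fun i => i + l) (f := F)
      (fun a _ b _ h => Nat.add_right_cancel h)]
    refine Finset.sum_le_sum_of_subset_of_nonneg ?_ fun i _ _ => hF i
    intro i hi
    obtain ⟨j, hj, rfl⟩ := Finset.mem_image.1 hi
    have := hS j hj
    rw [Finset.mem_Icc]
    omega
  refine (Finset.sum_le_sum this).trans ?_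
  simp

theorem exists_nat_sum_nid_sq_ge {κ : ℝ} (hκ : 0 < κ) : ∃ c : ℝ, 0 < c ∧ ∀ H : ℕ, 1 ≤ H → ∀ y : ℝ,
    1 / (2 * (⌊(H : ℝ) ^ κ⌋₊ : ℝ)) ≤ y → y ≤ 1 / 2 → ∃ N : ℕ, c ≤ y * (N : ℝ) ^ κ ∧
      c * N ≤ ∑ ℓ ∈ Finset.Icc 1 H, nid (psPart κ ℓ * y) ^ 2 := by
  have h2 : (0 : ℝ) < 2 ^ κ := by positivity
  set d : ℝ := 1 / (2 * 2 ^ κ) with hd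
  set e : ℝ := d / (2 * 2 ^ κ) with he
  have hd0 : 0 < d := by positivity
  have he0 : 0 < e := by positivity
  refine ⟨min d (e ^ 2 / 2), by positivity, fun H hH y hy hy2 => ?_⟩
  have hmono : ∀ m n : ℕ, m ≤ n → psPart κ m ≤ psPart κ n := fun m n h =>
    Nat.floor_mono (Real.rpow_le_rpow (by positivity) (by exact_mod_cast h) hκ.le)
  have hle : ∀ n : ℕ, (psPart κ n : ℝ) ≤ (n : ℝ) ^ κ := fun n => Nat.floor_le (by positivity)
  have hone : psPart κ 1 = 1 := by simp [psPart]
  have hH1 : (1 : ℝ) ≤ psPart κ H := by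
    have := hmono 1 H hH
    rw [hone] at this
    exact_mod_cast this
  have hy0 : 0 < y := lt_of_lt_of_le (by change 0 < 1 / (2 * (psPart κ H : ℝ)); positivity) hy
  have hyH : 1 / 2 ≤ psPart κ H * y := by
    change 1 / (2 * (psPart κ H : ℝ)) ≤ y at hy
    rw [div_le_iff₀ (by positivity)] at hy
    linarith
  obtain ⟨N, hN1, hNH, hNy, hNd⟩ : ∃ N : ℕ, 1 ≤ N ∧ N ≤ H ∧ psPart κ N * y ≤ 1 / 2 ∧
      1 / 2 ≤ (2 * N : ℝ) ^ κ * y := by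
    set N := Nat.findGreatest (fun n => (psPart κ n : ℝ) * y ≤ 1 / 2) H with hN
    have hN1 : 1 ≤ N := Nat.le_findGreatest hH (by rw [hone]; simpa using hy2)
    have hNH : N ≤ H := Nat.findGreatest_le H
    have hNs : (psPart κ N : ℝ) * y ≤ 1 / 2 :=
      Nat.findGreatest_spec (P := fun n => (psPart κ n : ℝ) * y ≤ 1 / 2) hH
        (by rw [hone]; simpa using hy2)
    refine ⟨N, hN1, hNH, hNs, ?_⟩
    have hN1' : (1 : ℝ) ≤ N := by exact_mod_cast hN1
    rcases hNH.lt_or_eq with h | h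
    · have h3 := Nat.findGreatest_is_greatest (P := fun n => (psPart κ n : ℝ) * y ≤ 1 / 2)
        (Nat.lt_succ_self N) h
      rw [not_le] at h3
      refine h3.le.trans (mul_le_mul_of_nonneg_right ((hle _).trans ?_) hy0.le)
      refine Real.rpow_le_rpow (by positivity) ?_ hκ.le
      push_cast
      linarith
    · refine hyH.trans (mul_le_mul_of_nonneg_right ((hle _).trans ?_) hy0.le)
      refine Real.rpow_le_rpow (by positivity) ?_ hκ.le
      rw [h] at hN1' ⊢
      linarith
  have hNd' : d ≤ y * (N : ℝ) ^ κ := by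
    rw [Real.mul_rpow (by norm_num) (by positivity)] at hNd
    rw [hd, div_le_iff₀ (by positivity)]
    linarith
  refine ⟨N, (min_le_left _ _).trans hNd', ?_⟩
  have hterm : ∀ ℓ ∈ Finset.Icc (N - N / 2) N, e ^ 2 ≤ nid (psPart κ ℓ * y) ^ 2 := by
    intro ℓ hℓ
    rw [Finset.mem_Icc] at hℓ
    have hup : (psPart κ ℓ : ℝ) * y ≤ 1 / 2 :=
      (mul_le_mul_of_nonneg_right (by exact_mod_cast hmono ℓ N hℓ.2) hy0.le).trans hNy
    rw [nid_eq_self (by positivity) hup]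
    refine pow_le_pow_left₀ he0.le ?_ 2
    have hℓ1 : 1 ≤ ℓ := by omega
    have hl : (N : ℝ) ^ κ ≤ 2 ^ κ * (ℓ : ℝ) ^ κ := by
      rw [← Real.mul_rpow (by norm_num) (by positivity)]
      refine Real.rpow_le_rpow (by positivity) ?_ hκ.le
      exact_mod_cast (by omega : N ≤ 2 * ℓ)
    have hf : (ℓ : ℝ) ^ κ ≤ 2 * psPart κ ℓ := by
      have h1 : (1 : ℝ) ≤ psPart κ ℓ := by
        have := hmono 1 ℓ hℓ1
        rw [hone] at this
        exact_mod_cast this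
      have h2 := Nat.lt_floor_add_one ((ℓ : ℝ) ^ κ)
      change (ℓ : ℝ) ^ κ < psPart κ ℓ + 1 at h2
      linarith
    rw [he, div_le_iff₀ (by positivity)]
    calc d ≤ y * (N : ℝ) ^ κ := hNd'
      _ ≤ y * (2 ^ κ * (2 * psPart κ ℓ)) := by gcongr; exact hl.trans (by gcongr)
      _ = _ := by ring
  calc min d (e ^ 2 / 2) * N ≤ e ^ 2 / 2 * N := by gcongr; exact min_le_right _ _
    _ ≤ (Finset.Icc (N - N / 2) N).card • e ^ 2 := by
      rw [nsmul_eq_mul, Nat.card_Icc]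
      have : (N : ℝ) ≤ 2 * ((N + 1 - (N - N / 2) : ℕ) : ℝ) := by
        exact_mod_cast (by omega : N ≤ 2 * (N + 1 - (N - N / 2)))
      nlinarith [sq_nonneg e]
    _ ≤ ∑ ℓ ∈ Finset.Icc (N - N / 2) N, nid (psPart κ ℓ * y) ^ 2 :=
      Finset.card_nsmul_le_sum _ _ _ hterm
    _ ≤ _ := Finset.sum_le_sum_of_subset_of_nonneg
      (Finset.Icc_subset_Icc (by omega) hNH) fun _ _ _ => sq_nonneg _

theorem exists_fwdDiff_floor_eq_one {u : ℕ → ℝ} {k : ℕ} (hu : ∀ i, 0 ≤ u i)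
    (hpos : ∀ i ≥ 1, 0 ≤ (fwdDiff 1)^[k + 1] u i)
    (hlim : Tendsto ((fwdDiff 1)^[k + 1] u) atTop (𝓝 0))
    (htop : Tendsto ((fwdDiff 1)^[k] u) atTop atTop) :
    ∃ (c : ℝ) (n₀ : ℕ), ∀ n ≥ n₀, ∃ r ≥ 1, (fwdDiff 1)^[k + 1] (fun i => (⌊u i⌋₊ : ℝ)) r = 1 ∧
      |(fwdDiff 1)^[k] u r - (n + c)| ≤ 1 / 4 := by
  set η₀ : ℝ := 1 / 4 / 2 ^ (k + 1) with hη₀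
  have hη₀' : 2 ^ (k + 1) * η₀ = 1 / 4 := by
    rw [hη₀]
    field_simp
  have hη₀4 : η₀ ≤ 1 / 4 := div_le_self (by norm_num) (one_le_pow₀ (by norm_num))
  obtain ⟨c, η, K, hη, hηη, hdesc⟩ :=
    exists_crosses_descend (η₀ := η₀) (by positivity) (k + 1) k
  obtain ⟨δ, hδ, hδη, hKδ⟩ : ∃ δ : ℝ, 0 < δ ∧ δ ≤ η ∧ K * δ ≤ η := by
    refine ⟨η / (K + 1), by positivity, div_le_self hη.le (by simp), ?_⟩
    rw [mul_div_assoc', div_le_iff₀ (by positivity)]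
    nlinarith
  obtain ⟨ℓ, hℓ⟩ := eventually_atTop.1 (hlim.eventually_le_const hδ)
  set b := max ℓ 1 with hb
  set g := (fwdDiff 1)^[k] u with hg
  have hstep : ∀ i, 0 ≤ g (b + (i + 1)) - g (b + i) ∧ g (b + (i + 1)) - g (b + i) ≤ δ := by
    intro i
    have h1 := hpos (b + i) (by omega)
    have h2 := hℓ (b + i) (by omega)
    rw [Function.iterate_succ_apply', fwdDiff] at h1 h2
    exact ⟨h1, h2⟩
  obtain ⟨n₀, hn₀⟩ := exists_nat_gt (g b + K * δ - c)
  refine ⟨c, n₀, fun n hn => ?_⟩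
  have hn' : (n₀ : ℝ) ≤ n := by exact_mod_cast hn
  obtain ⟨T, hTb, hT⟩ := ((eventually_ge_atTop b).and (htop.eventually_ge_atTop (c + n))).exists
  obtain ⟨T, rfl⟩ := Nat.exists_eq_add_of_le hTb
  obtain ⟨r, -, h1, h2⟩ := exists_crossing (w := fun i => g (b + i)) (x := c + n) (K := K) (T := T)
    (fun i _ => hstep i) (by rw [add_zero]; linarith) hT hδ.le
  have hcr : Crosses g c η K (b + r) := by
    refine ⟨fun i hi => ⟨n, ?_⟩, fun i hi => ⟨n, ?_⟩⟩
    · have := h1 i hi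
      simp only [Set.mem_Ico, ← add_assoc] at this
      constructor <;> push_cast <;> linarith [this.1, this.2]
    · have := h2 i hi
      simp only [Set.mem_Icc, ← add_assoc] at this
      constructor <;> push_cast <;> linarith [this.1, this.2]
  obtain ⟨r', hr1, hr2, hr3⟩ := hdesc u (b + r) hcr
  refine ⟨r', by omega, fwdDiff_floor_eq_one hu hη₀'.le hr3 ?_, ?_⟩
  · rw [abs_of_nonneg (hpos r' (by omega))]
    linarith [hℓ r' (by omega)]
  · obtain ⟨i, rfl⟩ := Nat.exists_eq_add_of_le hr1
    rw [abs_le]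
    rcases lt_or_ge i K with h | h
    · have := h1 i h
      simp only [Set.mem_Ico, ← add_assoc] at this
      constructor <;> linarith [this.1, this.2]
    · obtain ⟨j, rfl⟩ := Nat.exists_eq_add_of_le h
      have := h2 j (by omega)
      simp only [Set.mem_Icc, ← add_assoc] at this
      rw [← add_assoc]
      constructor <;> linarith [this.1, this.2]

theorem exists_finset_fwdDiff_floor_eq_one {u : ℕ → ℝ} {k : ℕ} (hu : ∀ i, 0 ≤ u i)
    (hpos : ∀ i ≥ 1, 0 ≤ (fwdDiff 1)^[k + 1] u i)
    (hlim : Tendsto ((fwdDiff 1)^[k + 1] u) atTop (𝓝 0))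
    (htop : Tendsto ((fwdDiff 1)^[k] u) atTop atTop) :
    ∃ C : ℝ, ∀ m ≥ 1, ∃ S : Finset ℕ, (∀ i ∈ S, 1 ≤ i ∧ i < m ∧
      (fwdDiff 1)^[k + 1] (fun i => (⌊u i⌋₊ : ℝ)) i = 1) ∧
      (fwdDiff 1)^[k] u m - C ≤ S.card := by
  obtain ⟨c, n₀, h⟩ := exists_fwdDiff_floor_eq_one hu hpos hlim htop
  have hmono : MonotoneOn ((fwdDiff 1)^[k] u) (Set.Ici 1) := by
    refine monotoneOn_nat_Ici_of_le_succ fun i hi => ?_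
    have := hpos i hi
    rw [Function.iterate_succ_apply', fwdDiff] at this
    linarith
  have h' : ∀ n, ∃ r, n₀ ≤ n → 1 ≤ r ∧ (fwdDiff 1)^[k + 1] (fun i => (⌊u i⌋₊ : ℝ)) r = 1 ∧
      |(fwdDiff 1)^[k] u r - (n + c)| ≤ 1 / 4 := by
    intro n
    by_cases hn : n₀ ≤ n
    · obtain ⟨r, hr⟩ := h n hn
      exact ⟨r, fun _ => hr⟩
    · exact ⟨0, fun h => absurd h hn⟩
  choose r hr using h'
  refine ⟨|c| + 2 + n₀, fun m hm => ?_⟩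
  set n₁ := ⌊(fwdDiff 1)^[k] u m - |c| - 1⌋₊ with hn₁
  refine ⟨(Finset.Ico n₀ n₁).image r, fun i hi => ?_, ?_⟩
  · obtain ⟨n, hn, rfl⟩ := Finset.mem_image.1 hi
    rw [Finset.mem_Ico] at hn
    obtain ⟨h1, h2, h3⟩ := hr n hn.1
    refine ⟨h1, ?_, h2⟩
    by_contra hlt
    have h4 := hmono hm h1 (not_lt.1 hlt)
    have h5 : n + 1 ≤ n₁ := hn.2
    rw [hn₁, Nat.le_floor_iff' (Nat.succ_ne_zero n)] at h5
    push_cast at h5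
    rw [abs_le] at h3
    linarith [h3.2, le_abs_self c]
  · rw [Finset.card_image_of_injOn, Nat.card_Ico]
    · have h1 := Nat.lt_floor_add_one ((fwdDiff 1)^[k] u m - |c| - 1)
      have h2 : (n₁ : ℝ) ≤ ((n₁ - n₀ : ℕ) : ℝ) + n₀ := by
        exact_mod_cast (by omega : n₁ ≤ n₁ - n₀ + n₀)
      linarith
    · intro a ha b hb hab
      rw [Finset.mem_coe, Finset.mem_Ico] at ha hb
      have h1 := (hr a ha.1).2.2
      have h2 := (hr b hb.1).2.2
      rw [hab] at h1
      rw [abs_le] at h1 h2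
      have h3 : (a : ℝ) < b + 1 := by linarith [h1.1, h2.2]
      have h4 : (b : ℝ) < a + 1 := by linarith [h1.2, h2.1]
      have h5 : a < b + 1 := by exact_mod_cast h3
      have h6 : b < a + 1 := by exact_mod_cast h4
      omega

theorem exists_finset_psPart {κ : ℝ} {k : ℕ} (hk : (k : ℝ) < κ) (hk' : κ < k + 1) :
    ∃ c C : ℝ, 0 < c ∧ ∀ H ≥ 2 * (k + 2), ∃ S : Finset ℕ, (∀ i ∈ S, 1 ≤ i ∧ i + (k + 1) ≤ H ∧
      (fwdDiff 1)^[k + 1] (fun i => (psPart κ i : ℝ)) i = 1) ∧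
      c * (H : ℝ) ^ (κ - k) - C ≤ S.card := by
  have hprod : ∀ j ≤ k + 1, 0 < ∏ i ∈ Finset.range j, (κ - i) := by
    refine fun j hj => Finset.prod_pos fun i hi => ?_
    rw [Finset.mem_range] at hi
    have : (i : ℝ) ≤ k := by exact_mod_cast (by omega : i ≤ k)
    linarith
  set u : ℕ → ℝ := fun i => (i : ℝ) ^ κ with hu
  have hdiff : ∀ j m : ℕ, 1 ≤ m → ∃ ξ, (m : ℝ) ≤ ξ ∧ (fwdDiff 1)^[j] u m =
      (∏ i ∈ Finset.range j, (κ - i)) * ξ ^ (κ - j) := by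
    intro j m hm
    rw [hu, fwdDiff_iter_natCast (fun x => x ^ κ)]
    exact fwdDiff_iter_rpow j κ m (by exact_mod_cast hm)
  have hlow : ∀ m : ℕ, 1 ≤ m → (∏ i ∈ Finset.range k, (κ - i)) * (m : ℝ) ^ (κ - k) ≤
      (fwdDiff 1)^[k] u m := by
    intro m hm
    obtain ⟨ξ, hξ, e⟩ := hdiff k m hm
    rw [e]
    exact mul_le_mul_of_nonneg_left (Real.rpow_le_rpow (by positivity) hξ (by linarith))
      (hprod k (by omega)).le
  have hpos : ∀ i ≥ 1, 0 ≤ (fwdDiff 1)^[k + 1] u i := by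
    intro m hm
    obtain ⟨ξ, hξ, e⟩ := hdiff (k + 1) m hm
    have : 0 ≤ ξ := le_trans (by positivity) hξ
    rw [e]
    exact mul_nonneg (hprod _ le_rfl).le (by positivity)
  have hup : ∀ m ≥ 1, (fwdDiff 1)^[k + 1] u m ≤
      (∏ i ∈ Finset.range (k + 1), (κ - i)) * (m : ℝ) ^ (-(k + 1 - κ)) := by
    intro m hm
    obtain ⟨ξ, hξ, e⟩ := hdiff (k + 1) m hm
    rw [e]
    refine mul_le_mul_of_nonneg_left ?_ (hprod _ le_rfl).le
    have : κ - ((k + 1 : ℕ) : ℝ) = -(k + 1 - κ) := by push_cast; ring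
    rw [this]
    exact Real.rpow_le_rpow_of_nonpos (by exact_mod_cast hm) hξ (by linarith)
  have hlim : Tendsto ((fwdDiff 1)^[k + 1] u) atTop (𝓝 0) := by
    have h0 := ((tendsto_rpow_neg_atTop (show 0 < k + 1 - κ by linarith)).comp
      tendsto_natCast_atTop_atTop).const_mul (∏ i ∈ Finset.range (k + 1), (κ - i))
    rw [mul_zero] at h0
    exact tendsto_of_tendsto_of_tendsto_of_le_of_le' tendsto_const_nhds h0
      ((eventually_ge_atTop 1).mono hpos) ((eventually_ge_atTop 1).mono hup)
  have htop : Tendsto ((fwdDiff 1)^[k] u) atTop atTop :=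
    tendsto_atTop_mono' _ ((eventually_ge_atTop 1).mono hlow)
      (((tendsto_rpow_atTop (show 0 < κ - k by linarith)).comp
        tendsto_natCast_atTop_atTop).const_mul_atTop (hprod k (by omega)))
  obtain ⟨C, hC⟩ := exists_finset_fwdDiff_floor_eq_one (fun i => by positivity) hpos hlim htop
  refine ⟨(∏ i ∈ Finset.range k, (κ - i)) * (1 / 2) ^ (κ - k), C,
    mul_pos (hprod k (by omega)) (by positivity), fun H hH => ?_⟩
  obtain ⟨S, hS, hcard⟩ := hC (H - (k + 1)) (by omega)
  refine ⟨S, fun i hi => ?_, le_trans ?_ hcard⟩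
  · obtain ⟨h1, h2, h3⟩ := hS i hi
    exact ⟨h1, by omega, h3⟩
  · have h1 := hlow (H - (k + 1)) (by omega)
    have h2 : (1 / 2 : ℝ) * H ≤ ((H - (k + 1) : ℕ) : ℝ) := by
      have : (H : ℝ) ≤ 2 * ((H - (k + 1) : ℕ) : ℝ) := by
        exact_mod_cast (by omega : H ≤ 2 * (H - (k + 1)))
      linarith
    have h3 := mul_le_mul_of_nonneg_left
      (Real.rpow_le_rpow (by positivity) h2 (show 0 ≤ κ - k by linarith)) (hprod k (by omega)).le
    rw [Real.mul_rpow (by norm_num) (by positivity), ← mul_assoc] at h3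
    linarith

theorem eventually_log_rpow_add_le {c θ : ℝ} (hc : 0 < c) (hθ : 0 < θ) (A C t : ℝ) :
    ∀ᶠ H : ℕ in atTop, A * Real.log H ^ t + C ≤ c * (H : ℝ) ^ θ := by
  have h1 := (isLittleO_log_rpow_rpow_atTop t hθ).const_mul_left A
  have h2 : (fun _ : ℝ => C) =o[atTop] fun x : ℝ => x ^ θ := by
    rw [Asymptotics.isLittleO_const_left]
    exact Or.inr (tendsto_norm_atTop_atTop.comp (tendsto_rpow_atTop hθ))
  have h3 := ((h1.add h2).bound hc).filter_mono tendsto_natCast_atTop_atTop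
  rw [Filter.eventually_map] at h3
  filter_upwards [h3] with H hH
  rw [Real.norm_of_nonneg (by positivity : (0 : ℝ) ≤ (H : ℝ) ^ θ)] at hH
  exact (le_abs_self _).trans hH

theorem stmt12 (κ : ℝ) (hκ : 0 < κ) (hκn : ∀ j : ℕ, κ ≠ (j : ℝ)) (M : ℝ) (hM : 0 < M) :
    ∃ H₀ : ℕ, ∀ H ≥ H₀, ∀ y : ℝ,
      1 / (2 * (⌊(H : ℝ) ^ κ⌋₊ : ℝ)) ≤ y → y ≤ 1 / 2 →
      M * Real.log H ≤ ∑ ℓ ∈ Finset.Icc 1 H, (nid ((psPart κ ℓ : ℝ) * y)) ^ 2 := by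
  obtain ⟨k, hk, hk'⟩ : ∃ k : ℕ, (k : ℝ) < κ ∧ κ < k + 1 :=
    ⟨⌊κ⌋₊, lt_of_le_of_ne (Nat.floor_le hκ.le) (hκn _).symm, Nat.lt_floor_add_one κ⟩
  obtain ⟨c, C, hc, hS⟩ := exists_finset_psPart hk hk'
  obtain ⟨d, hd, hN⟩ := exists_nat_sum_nid_sq_ge hκ
  obtain ⟨E, hE, hD⟩ := exists_sq_le_sum_nid_sq (k + 1)
  set B : ℝ := M / d with hB
  have hB0 : 0 < B := by positivity
  set A : ℝ := M * (E * ((k + 1 : ℕ) + 1)) / d ^ 2 with hA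
  have hA0 : 0 < A := by positivity
  obtain ⟨H₁, hH₁⟩ := eventually_atTop.1
    (eventually_log_rpow_add_le hc (sub_pos.2 hk) (A * (B ^ κ) ^ 2) C (κ + κ + 1))
  refine ⟨max H₁ (2 * (k + 2)), fun H hH y hy hy2 => ?_⟩
  have hH2 : 2 * (k + 2) ≤ H := (le_max_right _ _).trans hH
  have hL : 0 < Real.log H := Real.log_pos (by exact_mod_cast (by omega : 1 < H))
  have hy0 : 0 ≤ y := le_trans (by positivity) hy
  obtain ⟨N, hNy, hNs⟩ := hN H (by omega) y hy hy2
  rcases le_or_gt (B * Real.log H) N with hlog | hlog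
  · refine le_trans ?_ hNs
    calc M * Real.log H = d * (B * Real.log H) := by rw [hB]; field_simp
      _ ≤ d * N := by gcongr
  · obtain ⟨S, hS1, hcard⟩ := hS H hH2
    have hlarge := hH₁ H ((le_max_left _ _).trans hH)
    set Z : ℝ := (B * Real.log H) ^ κ with hZ
    have hyZ : d ≤ y * Z := hNy.trans
      (mul_le_mul_of_nonneg_left (Real.rpow_le_rpow (by positivity) hlog.le hκ.le) hy0)
    have hZe : (B ^ κ) ^ 2 * Real.log H ^ (κ + κ + 1) = Z ^ 2 * Real.log H := by
      rw [hZ, Real.mul_rpow hB0.le hL.le, Real.rpow_add hL, Real.rpow_add hL, Real.rpow_one]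
      ring
    have hScard : A * (Z ^ 2 * Real.log H) ≤ S.card := by
      rw [← hZe, ← mul_assoc]
      linarith
    have hsum : S.card * y ^ 2 ≤ E * (((k + 1 : ℕ) + 1) *
        ∑ ℓ ∈ Finset.Icc 1 H, (nid ((psPart κ ℓ : ℝ) * y)) ^ 2) := by
      calc S.card * y ^ 2 = ∑ i ∈ S, y ^ 2 := by rw [Finset.sum_const, nsmul_eq_mul]
        _ ≤ ∑ i ∈ S, E * ∑ l ∈ Finset.range (k + 1 + 1), nid (psPart κ (i + l) * y) ^ 2 :=
          Finset.sum_le_sum fun i hi => hD (psPart κ) i y hy0 hy2 (hS1 i hi).2.2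
        _ ≤ _ := by
          rw [← Finset.mul_sum]
          exact mul_le_mul_of_nonneg_left
            (sum_sum_shift_le (F := fun i => nid (psPart κ i * y) ^ 2) (fun _ => sq_nonneg _)
              fun i hi => ⟨(hS1 i hi).1, (hS1 i hi).2.1⟩) hE.le
    rw [← mul_assoc] at hsum
    refine le_of_mul_le_mul_left ?_ (show 0 < E * ((k + 1 : ℕ) + 1 : ℝ) by positivity)
    refine le_trans ?_ hsum
    calc E * ((k + 1 : ℕ) + 1 : ℝ) * (M * Real.log H) = A * Real.log H * d ^ 2 := by
          rw [hA]; field_simp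
      _ ≤ A * Real.log H * (y * Z) ^ 2 := by gcongr
      _ = A * (Z ^ 2 * Real.log H) * y ^ 2 := by ring
      _ ≤ S.card * y ^ 2 := by gcongr
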